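/- The ternary Thue–Morse word x = g^ω(0) avoids 2-binomial squares: for every n ∈ ℕ and all nonempty words u, v over the alphabet {0,1,2}, if the concatenation u·v occurs as a factor (contiguous subword) of g^n(0) and u ~_2 v, then a contradiction follows (no such factor exists). -/

import Mathlib

/-- Number of occurrences of `v` as a scattered subword (subsequence) of `u`. -/
def binomC {α : Type*} [DecidableEq α] (u v : List α) : ℕ := u.sublists.count v

/-- Two words are 2-binomially equivalent. -/
def binEq2 {α : Type*} [DecidableEq α] (u v : List α) : Prop :=
  ∀ x : List α, x.length ≤ 2 → binomC u x = binomC v x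

/-- The morphism g : 0 ↦ 012, 1 ↦ 02, 2 ↦ 1. -/
def g : Fin 3 → List (Fin 3) := ![[0,1,2],[0,2],[1]]

/-- Apply the morphism g to a word. -/
def gWord (w : List (Fin 3)) : List (Fin 3) := w.flatMap g

/-- The prefix g^n(0) of the ternary Thue–Morse word. -/
def gPow (n : ℕ) : List (Fin 3) := gWord^[n] [0]

/-- Number of occurrences of the two-letter word `ab` as a scattered subword. -/
def pairs (a b : Fin 3) : List (Fin 3) → ℤ
  | [] => 0
  | x :: w => (if x = a then (w.count b : ℤ) else 0) + pairs a b w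

/-- Number of occurrences of a letter, as an integer. -/
def occ (a : Fin 3) (w : List (Fin 3)) : ℤ := w.count a

/-- The weakening of 2-binomial equivalence that is inherited by preimages under `g`. -/
def WeakEq (u v : List (Fin 3)) : Prop :=
  (∀ a, occ a u = occ a v) ∧
    pairs 0 1 u - pairs 1 2 u = pairs 0 1 v - pairs 1 2 v

/-- Starting with balance `e`, every prefix keeps the balance (number of `0`s minus number
of `2`s) in `{0, 1}`. -/
def Alternates : ℤ → List (Fin 3) → Prop
  | e, [] => e = 0 ∨ e = 1
  | e, x :: w => (e = 0 ∨ e = 1) ∧ Alternates (e + occ 0 [x] - occ 2 [x]) w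

/-- The block `g b` contains a `0` and a `2`, with a cut preceded by `a` and followed by `r`
letters `1` between them. -/
def CutBlock (b : Fin 3) (a r : ℕ) : Prop :=
  (b = 0 ∧ a + r = 1) ∨ (b = 1 ∧ a = 0 ∧ r = 0)

@[simp] lemma occ_nil (a : Fin 3) : occ a [] = 0 := rfl

lemma occ_cons (a x : Fin 3) (w : List (Fin 3)) :
    occ a (x :: w) = occ a w + if x = a then 1 else 0 := by
  simp [occ, List.count_cons]

@[simp] lemma occ_append (a : Fin 3) (u v : List (Fin 3)) :
    occ a (u ++ v) = occ a u + occ a v := by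
  simp [occ]

lemma occ_nonneg (a : Fin 3) (w : List (Fin 3)) : 0 ≤ occ a w := by
  simp [occ]

lemma occ_replicate (a x : Fin 3) (n : ℕ) :
    occ a (List.replicate n x) = if x = a then (n : ℤ) else 0 := by
  simp [occ, List.count_replicate]

@[simp] lemma pairs_nil (a b : Fin 3) : pairs a b [] = 0 := rfl

lemma pairs_cons (a b x : Fin 3) (w : List (Fin 3)) :
    pairs a b (x :: w) = (if x = a then occ b w else 0) + pairs a b w := rfl

lemma pairs_append (a b : Fin 3) (u v : List (Fin 3)) :
    pairs a b (u ++ v) = pairs a b u + pairs a b v + occ a u * occ b v := by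
  induction u with
  | nil => simp
  | cons x u ih =>
    simp only [List.cons_append, pairs_cons, occ_cons, occ_append, ih]
    split_ifs <;> ring

lemma pairs_replicate {a b : Fin 3} (hab : a ≠ b) (x : Fin 3) (n : ℕ) :
    pairs a b (List.replicate n x) = 0 := by
  induction n with
  | zero => rfl
  | succ n ih =>
    rw [List.replicate_succ, pairs_cons, ih, occ_replicate]
    split_ifs with h₁ h₂
    · exact absurd (h₁.symm.trans h₂) hab
    · rfl
    · rfl

lemma binomC_nil {α : Type*} [DecidableEq α] (w : List α) : binomC w [] = 1 := by
  induction w with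
  | nil => simp [binomC]
  | cons x w ih =>
    rw [binomC, (List.sublists_perm_sublists' _).count_eq] at ih ⊢
    rw [List.sublists'_cons, List.count_append, ih, Nat.add_eq_left, List.count_eq_zero]
    simp

lemma binomC_cons_cons {α : Type*} [DecidableEq α] (x y : α) (w v : List α) :
    binomC (x :: w) (y :: v) = binomC w (y :: v) + if x = y then binomC w v else 0 := by
  simp only [binomC, (List.sublists_perm_sublists' _).count_eq]
  rw [List.sublists'_cons, List.count_append]
  congr 1
  split_ifs with h
  · subst h
    exact List.count_map_of_injective _ _ (List.cons_injective) _
  · rw [List.count_eq_zero]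
    simp [h]

lemma binomC_singleton (w : List (Fin 3)) (a : Fin 3) : (binomC w [a] : ℤ) = occ a w := by
  induction w with
  | nil => simp [binomC]
  | cons x w ih => simp [binomC_cons_cons, binomC_nil, occ_cons, ih]

lemma binomC_pair (w : List (Fin 3)) (a b : Fin 3) : (binomC w [a, b] : ℤ) = pairs a b w := by
  induction w with
  | nil => simp [binomC]
  | cons x w ih =>
    rw [binomC_cons_cons, pairs_cons, ← ih, ← binomC_singleton]
    push_cast
    ring

lemma binEq2.weakEq {u v : List (Fin 3)} (h : binEq2 u v) : WeakEq u v := by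
  refine ⟨fun a => ?_, ?_⟩
  · rw [← binomC_singleton, ← binomC_singleton, h [a] (by simp)]
  · simp only [← binomC_pair]
    rw [h [0, 1] (by simp), h [1, 2] (by simp)]

@[simp] lemma gWord_nil : gWord [] = [] := rfl

lemma gWord_cons (x : Fin 3) (w : List (Fin 3)) : gWord (x :: w) = g x ++ gWord w := rfl

lemma gWord_append (u v : List (Fin 3)) : gWord (u ++ v) = gWord u ++ gWord v := by
  simp [gWord]

lemma occ_gWord (w : List (Fin 3)) :
    occ 0 (gWord w) = occ 0 w + occ 1 w ∧ occ 1 (gWord w) = occ 0 w + occ 2 w ∧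
      occ 2 (gWord w) = occ 0 w + occ 1 w := by
  induction w with
  | nil => simp
  | cons x w ih =>
    obtain ⟨h0, h1, h2⟩ := ih
    fin_cases x <;> simp [gWord_cons, g, occ_cons, h0, h1, h2] <;> omega

lemma pairs_gWord (w : List (Fin 3)) :
    pairs 0 1 (gWord w) - pairs 1 2 (gWord w) =
      2 * (pairs 0 2 w + pairs 1 2 w - pairs 0 1 w) +
        occ 0 w * occ 1 w - occ 0 w * occ 2 w - occ 1 w * occ 2 w := by
  induction w with
  | nil => simp
  | cons x w ih =>
    obtain ⟨-, h1, h2⟩ := occ_gWord w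
    fin_cases x <;>
      simp [gWord_cons, g, occ_cons, pairs_cons, h1, h2] <;> linear_combination ih

lemma Alternates.start {e : ℤ} {w : List (Fin 3)} (h : Alternates e w) : e = 0 ∨ e = 1 := by
  cases w with
  | nil => exact h
  | cons => exact h.1

lemma Alternates.append {e : ℤ} {u v : List (Fin 3)} (h : Alternates e (u ++ v)) :
    Alternates e u ∧ Alternates (e + occ 0 u - occ 2 u) v := by
  induction u generalizing e with
  | nil => exact ⟨h.start, by simpa using h⟩
  | cons x u ih =>
    obtain ⟨h₁, h₂⟩ := ih h.2
    refine ⟨⟨h.1, h₁⟩, ?_⟩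
    convert h₂ using 1
    simp only [occ_cons, occ_nil]
    ring

/-- The number of subwords `02` of an alternating word is determined by its letter counts. -/
lemma Alternates.pairs_zero_two {e : ℤ} {w : List (Fin 3)} (h : Alternates e w) :
    2 * pairs 0 2 w = occ 0 w * occ 2 w + occ 0 w * (1 - 2 * e - occ 0 w + occ 2 w) := by
  induction w generalizing e with
  | nil => simp
  | cons x w ih =>
    have hw := ih h.2
    have h₁ := h.1
    have h₂ := h.2.start
    fin_cases x <;> simp [occ_cons, pairs_cons] at hw h₂ ⊢
    · obtain rfl : e = 0 := by omega
      linear_combination hw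
    · exact hw
    · obtain rfl : e = 1 := by omega
      linear_combination hw

lemma alternates_gWord (w : List (Fin 3)) : Alternates 0 (gWord w) := by
  induction w with
  | nil => exact Or.inl rfl
  | cons x w ih => fin_cases x <;> simpa [gWord_cons, g, Alternates, occ_cons] using ih

lemma alternates_gPow (n : ℕ) : Alternates 0 (gPow n) := by
  cases n with
  | zero => simp [gPow, Alternates, occ_cons]
  | succ n =>
    rw [gPow, Function.iterate_succ_apply']
    exact alternates_gWord _

lemma WeakEq.of_gWord {e : ℤ} {u v : List (Fin 3)} (halt : Alternates e (u ++ v))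
    (h : WeakEq (gWord u) (gWord v)) : WeakEq u v := by
  obtain ⟨hocc, hpairs⟩ := h
  obtain ⟨hu, hv⟩ := halt.append
  have hend := (Alternates.append (v := []) (by simpa using hv)).2.start
  have hmid := hv.start
  have hstart := hu.start
  have h0 := hocc 0
  have h1 := hocc 1
  rw [(occ_gWord u).1, (occ_gWord v).1] at h0
  rw [(occ_gWord u).2.1, (occ_gWord v).2.1] at h1
  rw [pairs_gWord, pairs_gWord] at hpairs
  have pu := hu.pairs_zero_two
  have pv := hv.pairs_zero_two
  obtain ⟨d, hd⟩ : ∃ d, occ 0 v = occ 0 u - d := ⟨occ 0 u - occ 0 v, by ring⟩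
  have e1 : occ 1 v = occ 1 u + d := by omega
  have e2 : occ 2 v = occ 2 u + d := by omega
  have d_bound : d = -1 ∨ d = 0 ∨ d = 1 := by omega
  simp only [hd, e1, e2] at hpairs pv
  have d_zero : d = 0 := by
    rcases d_bound with rfl | rfl | rfl
    · ring_nf at hpairs
      omega
    · rfl
    · ring_nf at hpairs
      omega
  subst d_zero
  have hbal : occ 0 u - occ 2 u = 0 := by omega
  refine ⟨fun a => ?_, ?_⟩
  · fin_cases a <;> simp [hd, e1, e2]
  · have he : e + occ 0 u - occ 2 u = e := by omega
    rw [he] at pv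
    simp only [sub_zero, add_zero] at pv hpairs
    linarith

lemma CutBlock.g_eq {b : Fin 3} {a r : ℕ} (h : CutBlock b a r) :
    g b = (0 :: List.replicate a 1) ++ (List.replicate r 1 ++ [2]) := by
  rcases h with ⟨rfl, h⟩ | ⟨rfl, rfl, rfl⟩
  · obtain ⟨rfl, rfl⟩ | ⟨rfl, rfl⟩ : (a = 0 ∧ r = 1) ∨ (a = 1 ∧ r = 0) := by omega
    · rfl
    · rfl
  · rfl

lemma CutBlock.occ_eq {b : Fin 3} {a r : ℕ} (h : CutBlock b a r) :
    occ 0 [b] = a + r ∧ occ 2 [b] = 0 ∧ a + r ≤ 1 := by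
  rcases h with ⟨rfl, h⟩ | ⟨rfl, rfl, rfl⟩
  · simp [occ_cons]
    omega
  · simp [occ_cons]

/-- A cut of `gWord w` lies either between two blocks or inside a block. -/
lemma gWord_eq_append {w A B : List (Fin 3)} (h : gWord w = A ++ B) :
    (∃ X Y, w = X ++ Y ∧ A = gWord X ∧ B = gWord Y) ∨
    ∃ X b Y a r, w = X ++ b :: Y ∧ CutBlock b a r ∧ A = gWord X ++ 0 :: List.replicate a 1 ∧
      B = List.replicate r 1 ++ 2 :: gWord Y := by
  induction w generalizing A with
  | nil =>
    obtain ⟨rfl, rfl⟩ := List.append_eq_nil_iff.1 h.symm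
    exact Or.inl ⟨[], [], rfl, rfl, rfl⟩
  | cons x w ih =>
    rw [gWord_cons, List.append_eq_append_iff] at h
    rcases h with ⟨A', rfl, h⟩ | ⟨B', h, rfl⟩
    · rcases ih h with ⟨X, Y, rfl, rfl, rfl⟩ | ⟨X, b, Y, a, r, rfl, hb, rfl, rfl⟩
      · exact Or.inl ⟨x :: X, Y, rfl, rfl, rfl⟩
      · exact Or.inr ⟨x :: X, b, Y, a, r, rfl, hb, by simp [gWord_cons], rfl⟩
    · rcases A with _ | ⟨y, A⟩
      · exact Or.inl ⟨[], x :: w, rfl, rfl, by rw [gWord_cons, h]; rfl⟩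
      rcases B' with _ | ⟨z, B'⟩
      · exact Or.inl ⟨[x], w, rfl, by simp [gWord_cons, h], rfl⟩
      right
      fin_cases x
      · rcases A with _ | ⟨y', _ | ⟨y'', A⟩⟩
        · simp [g] at h
          obtain ⟨rfl, rfl, rfl⟩ := h
          exact ⟨[], 0, w, 0, 1, rfl, by simp [CutBlock], rfl, rfl⟩
        · simp [g] at h
          obtain ⟨rfl, rfl, rfl, rfl⟩ := h
          exact ⟨[], 0, w, 1, 0, rfl, by simp [CutBlock], rfl, rfl⟩
        · simp [g] at h
      · rcases A with _ | ⟨y', A⟩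
        · simp [g] at h
          obtain ⟨rfl, rfl, rfl⟩ := h
          exact ⟨[], 1, w, 0, 0, rfl, by simp [CutBlock], rfl, rfl⟩
        · simp [g] at h
      · simp [g] at h

/-- If the two halves and both outer ends of a weak square cut blocks, then shifting all
three cuts to the beginning, or all to the end, of their blocks gives a weak square. -/
lemma WeakEq.shift {e : ℤ} {b₀ b₁ b₂ : Fin 3} {a₀ r₀ a₁ r₁ a₂ r₂ : ℕ} {Z₀ Z₁ : List (Fin 3)}
    (h₀ : CutBlock b₀ a₀ r₀) (h₁ : CutBlock b₁ a₁ r₁) (h₂ : CutBlock b₂ a₂ r₂)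
    (halt : Alternates e ([b₀] ++ (Z₀ ++ ([b₁] ++ (Z₁ ++ [b₂])))))
    (h : WeakEq (List.replicate r₀ 1 ++ 2 :: (gWord Z₀ ++ 0 :: List.replicate a₁ 1))
      (List.replicate r₁ 1 ++ 2 :: (gWord Z₁ ++ 0 :: List.replicate a₂ 1))) :
    WeakEq (gWord (b₀ :: Z₀)) (gWord (b₁ :: Z₁)) ∨
      WeakEq (gWord (Z₀ ++ [b₁])) (gWord (Z₁ ++ [b₂])) := by
  obtain ⟨hocc, hpairs⟩ := h
  have t₀ := h₀.occ_eq
  have t₁ := h₁.occ_eq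
  have t₂ := h₂.occ_eq
  obtain ⟨hs0, halt⟩ := halt.append
  obtain ⟨hs1, halt⟩ := halt.append
  obtain ⟨hs2, halt⟩ := halt.append
  obtain ⟨hs3, hs4⟩ := halt.append
  have hs5 := (Alternates.append (v := []) (by simpa using hs4)).2.start
  replace hs0 := hs0.start
  replace hs1 := hs1.start
  replace hs2 := hs2.start
  replace hs3 := hs3.start
  replace hs4 := hs4.start
  have o0 := hocc 0
  have o1 := hocc 1
  obtain ⟨p0, p1, p2⟩ := occ_gWord Z₀
  obtain ⟨q0, q1, q2⟩ := occ_gWord Z₁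
  have P := pairs_gWord Z₀
  have Q := pairs_gWord Z₁
  have hne01 : (0 : Fin 3) ≠ 1 := by decide
  have hne12 : (1 : Fin 3) ≠ 2 := by decide
  simp [occ_cons, occ_replicate, p0, p1, q0, q1] at o0 o1
  simp [pairs_append, pairs_cons, occ_cons, occ_replicate, pairs_replicate hne01,
    pairs_replicate hne12, p0, p1, p2, q0, q1, q2] at hpairs
  have key : (a₀ = a₁ ∧ a₁ = a₂) ∨ (r₀ = r₁ ∧ r₁ = r₂) := by
    obtain ⟨m, hm⟩ := Int.even_mul_succ_self (occ 0 Z₀)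
    obtain ⟨m', hm'⟩ := Int.even_mul_succ_self (occ 0 Z₁)
    have parity : occ 0 Z₀ - occ 0 Z₁ - (a₁ - r₀ - a₂ + r₁) =
        2 * (pairs 0 2 Z₀ + pairs 1 2 Z₀ - pairs 0 1 Z₀
          - (pairs 0 2 Z₁ + pairs 1 2 Z₁ - pairs 0 1 Z₁)
          + occ 0 Z₀ * occ 1 Z₀ - occ 0 Z₁ * occ 1 Z₁ + m - m'
          + (occ 0 Z₀ + occ 1 Z₀) * (a₁ - a₂)) := by
      linear_combination -hpairs + P - Q + hm - hm'
        - (occ 0 Z₁ + occ 2 Z₁ - a₂ + r₁) * o0 - (occ 0 Z₀ + occ 1 Z₀) * o1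
    generalize pairs 0 2 Z₀ + pairs 1 2 Z₀ - pairs 0 1 Z₀
          - (pairs 0 2 Z₁ + pairs 1 2 Z₁ - pairs 0 1 Z₁)
          + occ 0 Z₀ * occ 1 Z₀ - occ 0 Z₁ * occ 1 Z₁ + m - m'
          + (occ 0 Z₀ + occ 1 Z₀) * (a₁ - a₂) = M at parity
    clear P Q hpairs hm hm' hocc p0 p1 p2 q0 q1 q2 h₀ h₁ h₂
    have cases_of (a r : ℕ) (har : a + r ≤ 1) :
        (a = 0 ∧ r = 0) ∨ (a = 1 ∧ r = 0) ∨ (a = 0 ∧ r = 1) := by omega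
    rcases cases_of _ _ t₀.2.2 with ⟨rfl, rfl⟩ | ⟨rfl, rfl⟩ | ⟨rfl, rfl⟩ <;>
    rcases cases_of _ _ t₁.2.2 with ⟨rfl, rfl⟩ | ⟨rfl, rfl⟩ | ⟨rfl, rfl⟩ <;>
    rcases cases_of _ _ t₂.2.2 with ⟨rfl, rfl⟩ | ⟨rfl, rfl⟩ | ⟨rfl, rfl⟩ <;>
    first | (simp; done) | (exfalso; push_cast at *; omega)
  rcases key with ⟨rfl, rfl⟩ | ⟨rfl, rfl⟩
  · left
    refine ⟨fun a => ?_, ?_⟩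
    · fin_cases a <;> simp [gWord_cons, h₀.g_eq, h₁.g_eq, occ_cons, occ_replicate, p0, p1, p2,
        q0, q1, q2] <;> linarith
    · simp [gWord_cons, h₀.g_eq, h₁.g_eq, pairs_append, pairs_cons, occ_cons, occ_replicate,
        pairs_replicate hne01, pairs_replicate hne12, p1, p2, q1, q2]
      linear_combination hpairs + o1 - 2 * a₀ * o0
  · right
    refine ⟨fun a => ?_, ?_⟩
    · fin_cases a <;> simp [gWord_append, gWord_cons, h₂.g_eq, h₁.g_eq, occ_cons,
        occ_replicate, p0, p1, p2, q0, q1, q2] <;> linarith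
    · simp [gWord_append, gWord_cons, h₂.g_eq, h₁.g_eq, pairs_append, pairs_cons, occ_cons,
        occ_replicate, pairs_replicate hne01, pairs_replicate hne12, p0, p1, q0, q1]
      linear_combination hpairs - o1 + 2 * r₀ * o0

/-- The word between two consecutive cuts inside blocks. -/
lemma eq_of_cutBlock {X₀ X₁ Y u : List (Fin 3)} {b₀ b₁ : Fin 3} {a₁ r₀ r₁ : ℕ}
    (hb₁ : CutBlock b₁ a₁ r₁) (hX : X₁ ++ [b₁] = X₀ ++ b₀ :: Y)
    (hu : u ++ (List.replicate r₁ 1 ++ [2]) = List.replicate r₀ 1 ++ 2 :: gWord Y) :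
    Y = [] ∨ ∃ Z, Y = Z ++ [b₁] ∧
      u = List.replicate r₀ 1 ++ 2 :: (gWord Z ++ 0 :: List.replicate a₁ 1) := by
  rcases List.eq_nil_or_concat Y with rfl | ⟨Z, c, rfl⟩
  · exact Or.inl rfl
  rw [List.concat_eq_append] at hX hu ⊢
  rw [← List.cons_append, ← List.append_assoc] at hX
  obtain ⟨-, hc⟩ := List.append_inj' hX rfl
  obtain rfl : b₁ = c := by simpa using hc
  refine Or.inr ⟨Z, rfl, ?_⟩
  rw [← List.append_left_inj (List.replicate r₁ 1 ++ [2]), hu]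
  simp [gWord_append, gWord_cons, hb₁.g_eq]

lemma not_weakEq_of_append_infix_gPow (n : ℕ) (u v : List (Fin 3)) (hu : u ≠ [])
    (hfac : (u ++ v) <:+: gPow n) (h : WeakEq u v) : False := by
  induction n generalizing u v with
  | zero =>
    have hlen : u.length + v.length ≤ 1 := by simpa [gPow] using hfac.length_le
    have hu' := List.length_pos_of_ne_nil hu
    obtain rfl : v = [] := List.eq_nil_of_length_eq_zero (by omega)
    obtain ⟨x, u, rfl⟩ := List.exists_cons_of_ne_nil hu
    have := h.1 x
    have := occ_nonneg x u
    simp [occ_cons] at *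
    omega
  | succ n ih =>
    have halt := alternates_gPow n
    rw [gPow, Function.iterate_succ_apply'] at hfac
    change _ <:+: gWord (gPow n) at hfac
    generalize gPow n = w at hfac ih halt
    obtain ⟨P, S, hw⟩ := hfac
    have e0 := h.1 0
    have e2 := h.1 2
    have hP : occ 0 P - occ 2 P = 0 ∨ occ 0 P - occ 2 P = 1 := by
      have hg := alternates_gWord w
      rw [← hw, List.append_assoc] at hg
      simpa using hg.append.2.start
    rcases gWord_eq_append hw.symm with
      ⟨X₂, Y₂, rfl, hX₂, -⟩ | ⟨X₂, b₂, Y₂, a₂, r₂, rfl, hb₂, hX₂, -⟩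
    · have s₂ := congrArg (fun z => occ 0 z - occ 2 z) hX₂
      simp [occ_gWord] at s₂
      rw [← List.append_assoc] at hX₂
      rcases gWord_eq_append hX₂.symm with
        ⟨X₁, Y₁, rfl, hX₁, rfl⟩ | ⟨X₁, b₁, Y₁, a₁, r₁, rfl, hb₁, hX₁, -⟩
      · rcases gWord_eq_append hX₁.symm with
          ⟨X₀, Y₀, rfl, rfl, rfl⟩ | ⟨X₀, b₀, Y₀, a₀, r₀, rfl, hb₀, hX₀, -⟩
        · rw [List.append_assoc X₀] at halt
          exact ih Y₀ Y₁ (by rintro rfl; simp at hu) ⟨X₀, Y₂, by simp⟩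
            (h.of_gWord halt.append.1.append.2)
        · exfalso
          have s₁ := congrArg (fun z => occ 0 z - occ 2 z) hX₁
          have s₀ := congrArg (fun z => occ 0 z - occ 2 z) hX₀
          simp [occ_gWord, occ_cons, occ_replicate] at s₀ s₁
          omega
      · exfalso
        have s₁ := congrArg (fun z => occ 0 z - occ 2 z) hX₁
        simp [occ_gWord, occ_cons, occ_replicate] at s₁
        omega
    · have s₂ := congrArg (fun z => occ 0 z - occ 2 z) hX₂
      simp [occ_gWord, occ_cons, occ_replicate] at s₂
      have hX₂' : gWord (X₂ ++ [b₂]) = (P ++ u) ++ (v ++ (List.replicate r₂ 1 ++ [2])) := by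
        have := congrArg (· ++ (List.replicate r₂ 1 ++ [2])) hX₂
        simpa [gWord_append, gWord_cons, hb₂.g_eq] using this.symm
      rcases gWord_eq_append hX₂' with
        ⟨X₁, Y₁, hw₁, hX₁, -⟩ | ⟨X₁, b₁, Y₁, a₁, r₁, hw₁, hb₁, hX₁, hv₁⟩
      · exfalso
        have s₁ := congrArg (fun z => occ 0 z - occ 2 z) hX₁
        simp [occ_gWord] at s₁
        omega
      have s₁ := congrArg (fun z => occ 0 z - occ 2 z) hX₁
      simp [occ_gWord, occ_cons, occ_replicate] at s₁
      have hX₁' : gWord (X₁ ++ [b₁]) = P ++ (u ++ (List.replicate r₁ 1 ++ [2])) := by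
        have := congrArg (· ++ (List.replicate r₁ 1 ++ [2])) hX₁
        simpa [gWord_append, gWord_cons, hb₁.g_eq] using this.symm
      rcases gWord_eq_append hX₁' with
        ⟨X₀, Y₀, hw₀, hX₀, -⟩ | ⟨X₀, b₀, Y₀, a₀, r₀, hw₀, hb₀, hX₀, hu₀⟩
      · exfalso
        have s₀ := congrArg (fun z => occ 0 z - occ 2 z) hX₀
        simp [occ_gWord] at s₀
        omega
      have e1 := h.1 1
      rcases eq_of_cutBlock hb₁ hw₀ hu₀ with rfl | ⟨Z₀, rfl, rfl⟩ <;>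
        rcases eq_of_cutBlock hb₂ hw₁ hv₁ with rfl | ⟨Z₁, rfl, rfl⟩
      · have cu := congrArg List.length hu₀
        have cv := congrArg List.length hv₁
        have hlen := List.length_pos_of_ne_nil hu
        have cu1 := congrArg (occ 1) hu₀
        have cv1 := congrArg (occ 1) hv₁
        have t₀ := hb₀.occ_eq
        simp [occ_cons, occ_replicate] at cu cv cu1 cv1
        omega
      · have c0 := congrArg (occ 0) hu₀
        have := occ_nonneg 0 (gWord Z₁)
        simp [occ_cons, occ_replicate] at c0 e0
        omega
      · have c0 := congrArg (occ 0) hv₁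
        have := occ_nonneg 0 (gWord Z₀)
        simp [occ_cons, occ_replicate] at c0 e0
        omega
      · obtain rfl : X₁ = X₀ ++ b₀ :: Z₀ := by
          rw [← List.cons_append, ← List.append_assoc] at hw₀
          exact (List.append_inj' hw₀ rfl).1
        obtain rfl : X₂ = X₀ ++ b₀ :: Z₀ ++ b₁ :: Z₁ := by
          rw [← List.cons_append, ← List.append_assoc] at hw₁
          exact (List.append_inj' hw₁ rfl).1
        have hsplit : X₀ ++ b₀ :: Z₀ ++ b₁ :: Z₁ ++ b₂ :: Y₂ =
            X₀ ++ (([b₀] ++ (Z₀ ++ ([b₁] ++ (Z₁ ++ [b₂])))) ++ Y₂) := by simp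
        rw [hsplit] at halt ih
        have halt' := halt.append.2.append.1
        rcases WeakEq.shift hb₀ hb₁ hb₂ halt' h with h' | h'
        · have := Alternates.append (u := (b₀ :: Z₀) ++ (b₁ :: Z₁)) (v := [b₂])
            (by simpa using halt')
          exact ih (b₀ :: Z₀) (b₁ :: Z₁) (by simp) ⟨X₀, b₂ :: Y₂, by simp⟩
            (h'.of_gWord this.1)
        · have := halt'.append.2
          rw [← List.append_assoc Z₀] at this
          exact ih (Z₀ ++ [b₁]) (Z₁ ++ [b₂]) (by simp) ⟨X₀ ++ [b₀], Y₂, by simp⟩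
            (h'.of_gWord this)

/-- The ternary Thue–Morse word avoids 2-binomial squares. -/
theorem ternary_thue_morse_avoids_2binomial_squares
    (n : ℕ) (u v : List (Fin 3)) (hu : u ≠ []) (hv : v ≠ [])
    (hfac : (u ++ v) <:+: gPow n) (h2 : binEq2 u v) : False :=
  not_weakEq_of_append_infix_gPow n u v hu hfac h2.weakEq
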